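/- For every integer n ≥ 3, f(0,2,n) = 2√π · E(max_{1≤i≤n} |g_i|), where g_1, …, g_n are independent standard N(0,1) Gaussian random variables; equivalently, f(0,2,n) = 2√π · ∫_0^∞ (1 − (√(2/π) ∫_0^t e^{-x²/2} dx)^n) dt. -/

import Mathlib

open MeasureTheory Filter Real

noncomputable section

/-- The orthogonal group O(n) of ℝⁿ. -/
abbrev OG (n : ℕ) : Type := Matrix.orthogonalGroup (Fin n) ℝ

instance (n : ℕ) : MeasurableSpace (OG n) := borel _
instance (n : ℕ) : BorelSpace (OG n) := ⟨rfl⟩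

/-- The natural action of `g ∈ O(n)` on `ℝⁿ`. -/
def act {n : ℕ} (g : OG n) (x : EuclideanSpace ℝ (Fin n)) : EuclideanSpace ℝ (Fin n) :=
  Matrix.toEuclideanLin (g : Matrix (Fin n) (Fin n) ℝ) x

/-- `E_k`: the span of the first `k` standard basis vectors of `ℝⁿ`, as a set. -/
def Ek (n k : ℕ) : Set (EuclideanSpace ℝ (Fin n)) :=
  {x | ∀ i : Fin n, k ≤ (i : ℕ) → x i = 0}

/-- The `m`-dimensional face `{x : |xᵢ| ≤ 1 for i < m, xᵢ = 1 for i ≥ m}` of the cube `[-1,1]ⁿ`. -/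
def cubeFace (n m : ℕ) : Set (EuclideanSpace ℝ (Fin n)) :=
  {x | (∀ i : Fin n, (i : ℕ) < m → |x i| ≤ 1) ∧ ∀ i : Fin n, m ≤ (i : ℕ) → x i = 1}

/-- `f(j,k,n)`, the expected number of `j`-faces of a random `k`-section of the `n`-cube,
computed with respect to the probability measure `H` on `O(n)`. -/
def expFaces (n : ℕ) (H : Measure (OG n)) (j k : ℕ) : ℝ :=
  2 ^ (k - j) * (n.choose (k - j)) *
    (H {g | (act g '' Ek n k ∩ cubeFace n (n - k + j)).Nonempty}).toReal

open ProbabilityTheory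

/-- Standard Gaussian measure on `Fin n → ℝ`. -/
def gm (n : ℕ) : Measure (Fin n → ℝ) := Measure.pi (fun _ => gaussianReal 0 1)

instance (n : ℕ) : IsProbabilityMeasure (gm n) := by unfold gm; infer_instance

lemma gm_map_linear {n : ℕ} (L : (Fin n → ℝ) →ₗ[ℝ] (Fin n → ℝ))
    (hL : ∀ x, ∑ i, (L x i) ^ 2 = ∑ i, (x i) ^ 2) : MeasurePreserving L (gm n) (gm n) := by
  have hLm : Measurable L := (LinearMap.continuous_of_finiteDimensional L).measurable
  refine ⟨hLm, ?_⟩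
  let e := WithLp.linearEquiv 2 ℝ (Fin n → ℝ)
  let L' : EuclideanSpace ℝ (Fin n) →ₗ[ℝ] EuclideanSpace ℝ (Fin n) :=
    (e.symm.toLinearMap ∘ₗ L) ∘ₗ e.toLinearMap
  let f : EuclideanSpace ℝ (Fin n) →ₗᵢ[ℝ] EuclideanSpace ℝ (Fin n) :=
    ⟨L', by
      intro x
      have := hL (x.ofLp)
      rw [EuclideanSpace.norm_eq, EuclideanSpace.norm_eq]
      congr 1
      simpa [L', e] using this⟩
  let f' := f.toLinearIsometryEquiv rfl
  have h1 := stdGaussian_map f'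
  rw [← map_pi_eq_stdGaussian] at h1
  have h2 := congrArg (Measure.map (WithLp.ofLp (p := 2) (V := Fin n → ℝ))) h1
  rw [Measure.map_map (by fun_prop) (by fun_prop), Measure.map_map (by fun_prop) (by fun_prop),
    Measure.map_map (by fun_prop) (by fun_prop)] at h2
  have h3 : (WithLp.ofLp (p := 2) (V := Fin n → ℝ)) ∘ (WithLp.toLp 2) = id := by
    ext x; simp
  have h4 : ((WithLp.ofLp (p := 2) (V := Fin n → ℝ)) ∘ f') ∘ (WithLp.toLp 2) = L := by
    ext x; simp [f', f, L', e]
  rw [h3, Measure.map_id] at h2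
  rw [gm, ← h4]
  convert h2 using 2

lemma orth_sq {n : ℕ} (g : OG n) (x : Fin n → ℝ) :
    ∑ i, (((g : Matrix (Fin n) (Fin n) ℝ).mulVec x) i) ^ 2 = ∑ i, (x i) ^ 2 := by
  have h := (Matrix.mem_orthogonalGroup_iff' (Fin n) ℝ).1 g.2
  have : (g : Matrix (Fin n) (Fin n) ℝ).mulVec x ⬝ᵥ (g : Matrix (Fin n) (Fin n) ℝ).mulVec x
      = x ⬝ᵥ x := by
    rw [Matrix.dotProduct_mulVec, Matrix.vecMul_mulVec, ← Matrix.dotProduct_mulVec]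
    have h' : (g : Matrix (Fin n) (Fin n) ℝ).transpose * (g : Matrix (Fin n) (Fin n) ℝ) = 1 := h
    rw [h', Matrix.one_mulVec]
  simpa [dotProduct, sq] using this

lemma gm_orth {n : ℕ} (g : OG n) :
    MeasurePreserving (fun x => (g : Matrix (Fin n) (Fin n) ℝ).mulVec x) (gm n) (gm n) :=
  gm_map_linear (Matrix.mulVecLin (g : Matrix (Fin n) (Fin n) ℝ)) (orth_sq g)

instance og_compact (n : ℕ) : CompactSpace (OG n) := by
  refine isCompact_iff_compactSpace.1 (show IsCompact ((Matrix.orthogonalGroup (Fin n) ℝ :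
      Submonoid _) : Set (Matrix (Fin n) (Fin n) ℝ)) from ?_)
  have hc : IsClosed ((Matrix.orthogonalGroup (Fin n) ℝ : Submonoid _) :
      Set (Matrix (Fin n) (Fin n) ℝ)) := by
    have : ((Matrix.orthogonalGroup (Fin n) ℝ : Submonoid _) :
      Set (Matrix (Fin n) (Fin n) ℝ)) = {A | star A * A = 1} := by
      ext A; exact Matrix.mem_orthogonalGroup_iff' (Fin n) ℝ
    rw [this]
    exact isClosed_eq (by fun_prop) continuous_const
  have hK : IsCompact (Set.univ.pi fun _ : Fin n => Set.univ.pi fun _ : Fin n => Set.Icc (-1:ℝ) 1) :=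
    isCompact_univ_pi fun _ => isCompact_univ_pi fun _ => isCompact_Icc
  refine IsCompact.of_isClosed_subset hK hc ?_
  intro A hA i _ j _
  have := entry_norm_bound_of_unitary (𝕜 := ℝ) hA i j
  rw [Real.norm_eq_abs] at this
  exact abs_le.1 this

lemma haar_right {n : ℕ} (H : Measure (OG n)) [H.IsHaarMeasure] [IsProbabilityMeasure H] (h : OG n) :
    MeasurePreserving (fun g => g * h) H H := by
  have hm : Measurable (fun g : OG n => g * h) := (continuous_mul_const h).measurable
  refine ⟨hm, ?_⟩
  have : IsProbabilityMeasure (H.map (fun g => g * h)) :=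
    Measure.isProbabilityMeasure_map hm.aemeasurable
  have := Measure.isMulInvariant_eq_smul_of_compactSpace (H.map (fun g => g * h)) H
  have h2 := congrArg (fun μ => μ Set.univ) this
  simp only [measure_univ, Measure.smul_apply] at h2
  rw [this]
  have h3 : (H.map (fun g => g * h)).haarScalarFactor H = 1 := by
    simpa [ENNReal.smul_def, eq_comm] using h2
  rw [h3, one_smul]

/-- determinant of the last two rows -/
def Dt {m : ℕ} (p : (Fin (m+2) → ℝ) × (Fin (m+2) → ℝ)) : ℝ :=
  p.1 (Fin.last m).castSucc * p.2 (Fin.last (m+1)) -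
    p.2 (Fin.last m).castSucc * p.1 (Fin.last (m+1))

def col {n : ℕ} (g : OG n) (j : Fin n) : Fin n → ℝ := fun i => (g : Matrix (Fin n) (Fin n) ℝ) i j

lemma exists_frame {m : ℕ} (U V : Fin (m+2) → ℝ) : ∃ h : OG (m+2), ∃ a b c d : ℝ,
    U = a • col h 0 + b • col h 1 ∧ V = c • col h 0 + d • col h 1 := by
  let f : Fin (m+2) → EuclideanSpace ℝ (Fin (m+2)) := fun i =>
    if i = 0 then WithLp.toLp 2 U else if i = 1 then WithLp.toLp 2 V else 0
  let b := InnerProductSpace.gramSchmidtOrthonormalBasis (𝕜 := ℝ) (E := EuclideanSpace ℝ (Fin (m+2)))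
    (by simp) f
  let h : OG (m+2) := ⟨(EuclideanSpace.basisFun _ ℝ).toBasis.toMatrix b,
    OrthonormalBasis.toMatrix_orthonormalBasis_mem_orthogonal _ _⟩
  have hcol : ∀ j, col h j = (b j).ofLp := by
    intro j; ext i
    simp [col, h, Module.Basis.toMatrix_apply]
  have htri : ∀ i j, i < j → inner ℝ (b j) (f i) = 0 := fun i j hij =>
    InnerProductSpace.gramSchmidtOrthonormalBasis_inv_triangular (𝕜 := ℝ) _ f hij
  have key : ∀ i, (i = 0 ∨ i = 1) → f i = inner ℝ (b 0) (f i) • b 0 + inner ℝ (b 1) (f i) • b 1 := by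
    intro i hi
    conv_lhs => rw [← b.sum_repr' (f i)]
    rw [Fin.sum_univ_succ, Fin.sum_univ_succ]
    rw [Finset.sum_eq_zero]
    · simp
    · intro j _
      rw [htri, zero_smul]
      rcases hi with rfl | rfl
      · exact Fin.succ_pos _
      · rw [Fin.lt_def]; simp
  refine ⟨h, inner ℝ (b 0) (f 0), inner ℝ (b 1) (f 0), inner ℝ (b 0) (f 1), inner ℝ (b 1) (f 1), ?_, ?_⟩
  · have := congrArg WithLp.ofLp (key 0 (Or.inl rfl))
    rw [hcol, hcol]
    simpa [f] using this
  · have := congrArg WithLp.ofLp (key 1 (Or.inr rfl))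
    rw [hcol, hcol]
    simpa [f] using this

lemma mulVec_col {n : ℕ} (g h : OG n) (j : Fin n) :
    (g : Matrix (Fin n) (Fin n) ℝ).mulVec (col h j) = col (g * h) j := by
  ext i; simp [col, Matrix.mulVec, dotProduct, Matrix.mul_apply]

lemma haar_eq_gauss {m : ℕ} (H : Measure (OG (m+2))) [H.IsHaarMeasure] [IsProbabilityMeasure H]
    (hD : ((gm (m+2)).prod (gm (m+2))) {p | Dt p = 0} = 0)
    (S : Set ((Fin (m+2) → ℝ) × (Fin (m+2) → ℝ))) (hS : MeasurableSet S)
    (hinv : ∀ U V : Fin (m+2) → ℝ, ∀ a b c d : ℝ, a * d - b * c ≠ 0 → (U, V) ∈ S →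
      (a • U + b • V, c • U + d • V) ∈ S) :
    H {g | (col g 0, col g 1) ∈ S} = ((gm (m+2)).prod (gm (m+2))) S := by
  set γ := (gm (m+2)).prod (gm (m+2)) with hγ
  have hinv' : ∀ U V : Fin (m+2) → ℝ, ∀ a b c d : ℝ, a * d - b * c ≠ 0 →
      ((a • U + b • V, c • U + d • V) ∈ S ↔ (U, V) ∈ S) := by
    intro U V a b c d h
    refine ⟨fun h1 => ?_, hinv U V a b c d h⟩
    have := hinv _ _ (d / (a * d - b * c)) (-b / (a * d - b * c)) (-c / (a * d - b * c))
      (a / (a * d - b * c)) (by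
        have : d / (a * d - b * c) * (a / (a * d - b * c)) -
          (-b / (a * d - b * c)) * (-c / (a * d - b * c)) = 1 / (a * d - b * c) := by
          field_simp
        rw [this]; exact one_div_ne_zero h) h1
    convert this using 2
    · ext i
      simp only [Pi.add_apply, Pi.smul_apply, smul_eq_mul]
      trans (a * d - b * c) * U i / (a * d - b * c)
      · rw [mul_div_cancel_left₀ _ h]
      · ring
    · ext i
      simp only [Pi.add_apply, Pi.smul_apply, smul_eq_mul]
      trans (a * d - b * c) * V i / (a * d - b * c)
      · rw [mul_div_cancel_left₀ _ h]
      · ring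
  let F : OG (m+2) × ((Fin (m+2) → ℝ) × (Fin (m+2) → ℝ)) → (Fin (m+2) → ℝ) × (Fin (m+2) → ℝ) :=
    fun z => ((z.1 : Matrix _ _ ℝ).mulVec z.2.1, (z.1 : Matrix _ _ ℝ).mulVec z.2.2)
  have hFc : Continuous F := by
    have : Continuous fun z : OG (m+2) × ((Fin (m+2) → ℝ) × (Fin (m+2) → ℝ)) =>
      (z.1 : Matrix (Fin (m+2)) (Fin (m+2)) ℝ) := continuous_subtype_val.comp continuous_fst
    exact (this.matrix_mulVec (by fun_prop)).prodMk (this.matrix_mulVec (by fun_prop))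
  have : SecondCountableTopology (Matrix (Fin (m+2)) (Fin (m+2)) ℝ) :=
    inferInstanceAs (SecondCountableTopology (Fin (m+2) → Fin (m+2) → ℝ))
  have : SecondCountableTopology (OG (m+2)) :=
    TopologicalSpace.Subtype.secondCountableTopology _
  have hZ : MeasurableSet (F ⁻¹' S) := hFc.measurable hS
  have e1 := Measure.prod_apply (μ := H) (ν := γ) hZ
  have e2 := Measure.prod_apply_symm (μ := H) (ν := γ) hZ
  have e3 : ∀ g : OG (m+2), γ (Prod.mk g ⁻¹' (F ⁻¹' S)) = γ S := by
    intro g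
    have := ((gm_orth g).prod (gm_orth g)).measure_preimage hS.nullMeasurableSet
    exact this
  have e4 : ∀ᵐ p ∂γ, H ((fun g => (g, p)) ⁻¹' (F ⁻¹' S)) = H {g | (col g 0, col g 1) ∈ S} := by
    have : ∀ᵐ p ∂γ, Dt p ≠ 0 := by
      rw [ae_iff]; simpa using hD
    filter_upwards [this] with p hp
    obtain ⟨U, V⟩ := p
    obtain ⟨h, a, b, c, d, hU, hV⟩ := exists_frame U V
    have hne : a * d - b * c ≠ 0 := by
      intro h0
      apply hp
      have : Dt (U, V) = (a * d - b * c) * Dt (col h 0, col h 1) := by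
        simp only [Dt, hU, hV, Pi.add_apply, Pi.smul_apply, smul_eq_mul]; ring
      rw [this, h0, zero_mul]
    have hset : (fun g => (g, (U, V))) ⁻¹' (F ⁻¹' S) =
        (fun g => g * h) ⁻¹' {g | (col g 0, col g 1) ∈ S} := by
      ext g
      simp only [Set.mem_preimage, Set.mem_ofPred_eq, F, hU, hV, Matrix.mulVec_add,
        Matrix.mulVec_smul, mulVec_col]
      exact hinv' _ _ _ _ _ _ hne
    rw [hset]
    refine (haar_right H h).measure_preimage ?_
    apply MeasurableSet.nullMeasurableSet
    have hc : Continuous fun g : OG (m+2) => (col g 0, col g 1) := by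
      have : Continuous fun g : OG (m+2) => (g : Matrix (Fin (m+2)) (Fin (m+2)) ℝ) :=
        continuous_subtype_val
      refine Continuous.prodMk ?_ ?_ <;>
      exact continuous_pi fun i => this.matrix_elem i _
    exact hc.measurable hS
  rw [lintegral_congr_ae e4, e1, lintegral_congr e3] at e2
  simpa using e2.symm

lemma gauss_lin (u v : ℝ) :
    ((gaussianReal 0 1).prod (gaussianReal 0 1)).map (fun z : ℝ × ℝ => v * z.1 - u * z.2) =
      (gaussianReal 0 1).map (fun x => √(u ^ 2 + v ^ 2) * x) := by
  have h1 := gaussianReal_map_const_mul (μ := 0) (v := 1) v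
  have h2 := gaussianReal_map_const_mul (μ := 0) (v := 1) (-u)
  have h3 := gaussianReal_map_const_mul (μ := 0) (v := 1) (√(u ^ 2 + v ^ 2))
  have : (fun z : ℝ × ℝ => v * z.1 - u * z.2) =
      (fun z : ℝ × ℝ => z.1 + z.2) ∘ Prod.map (fun x => v * x) (fun x => -u * x) := by
    ext z; simp; ring
  rw [this, ← Measure.map_map (by fun_prop) (by fun_prop),
    ← Measure.map_prod_map _ _ (by fun_prop) (by fun_prop), h1, h2, h3]
  have := gaussianReal_conv_gaussianReal (m₁ := v * 0) (m₂ := -u * 0)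
    (v₁ := (.mk (v ^ 2) (sq_nonneg _) * 1)) (v₂ := (.mk ((-u) ^ 2) (sq_nonneg _) * 1))
  rw [Measure.conv] at this
  rw [this]
  congr 1
  · simp
  · ext
    simp [Real.sq_sqrt (add_nonneg (sq_nonneg u) (sq_nonneg v)), add_comm]

lemma gauss_section {m : ℕ} (T : Set (Fin (m+1) → ℝ)) (hT : MeasurableSet T)
    (hhom : ∀ c : ℝ, 0 < c → ∀ w, c • w ∈ T ↔ w ∈ T) :
    ((gm (m+2)).prod (gm (m+2))) {p | (fun i : Fin (m+1) =>
      p.2 (Fin.last (m+1)) * p.1 i.castSucc - p.1 (Fin.last (m+1)) * p.2 i.castSucc) ∈ T} =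
    gm (m+1) T := by
  let ν := (gaussianReal 0 1).prod (gaussianReal 0 1)
  have P1 := measurePreserving_arrowProdEquivProdArrow ℝ ℝ (Fin (m+2))
    (fun _ => gaussianReal 0 1) (fun _ => gaussianReal 0 1)
  have P2 := measurePreserving_piFinSuccAbove (fun _ : Fin (m+2) => ν) (Fin.last (m+1))
  set S := {p : (Fin (m+2) → ℝ) × (Fin (m+2) → ℝ) | (fun i : Fin (m+1) =>
      p.2 (Fin.last (m+1)) * p.1 i.castSucc - p.1 (Fin.last (m+1)) * p.2 i.castSucc) ∈ T} with hSdef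
  have hS : MeasurableSet S := by
    refine (measurable_pi_lambda _ fun i => ?_) hT
    fun_prop
  let S2 : Set ((ℝ × ℝ) × (Fin (m+1) → ℝ × ℝ)) :=
    {z | (fun i => z.1.2 * (z.2 i).1 - z.1.1 * (z.2 i).2) ∈ T}
  have hS2 : MeasurableSet S2 := by
    refine (measurable_pi_lambda _ fun i => ?_) hT
    fun_prop
  have e1 := P1.measure_preimage hS.nullMeasurableSet
  have e2 := P2.measure_preimage hS2.nullMeasurableSet
  have e3 : (MeasurableEquiv.arrowProdEquivProdArrow ℝ ℝ (Fin (m+2))) ⁻¹' S =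
      (MeasurableEquiv.piFinSuccAbove (fun _ : Fin (m+2) => ℝ × ℝ) (Fin.last (m+1))) ⁻¹' S2 := by
    ext z
    simp [S, S2, MeasurableEquiv.arrowProdEquivProdArrow, Equiv.arrowProdEquivProdArrow,
      MeasurableEquiv.piFinSuccAbove, Fin.init]
  rw [e3] at e1
  have e4 := e1.symm.trans e2
  refine Eq.trans e4 ?_
  rw [Measure.prod_apply hS2]
  have hne : ∀ᵐ q ∂ν, q.1 ≠ 0 := by
    have : NullSingletonClass (gaussianReal 0 1) := nullSingletonClass_gaussianReal one_ne_zero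
    have h0 : ∀ᵐ x ∂(gaussianReal 0 1), x ≠ 0 := by
      rw [ae_iff]; simp
    exact Measure.quasiMeasurePreserving_fst.ae h0
  have e5 : ∀ᵐ q ∂ν, (Measure.pi fun _ : Fin (m+1) => ν) (Prod.mk q ⁻¹' S2) = gm (m+1) T := by
    filter_upwards [hne] with q hq
    have hc : 0 < √(q.1 ^ 2 + q.2 ^ 2) := by positivity
    have a1 := Measure.pi_map_pi (μ := fun _ : Fin (m+1) => ν)
      (f := fun _ (z : ℝ × ℝ) => q.2 * z.1 - q.1 * z.2) (fun _ => by fun_prop)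
    have a2 := Measure.pi_map_pi (μ := fun _ : Fin (m+1) => gaussianReal 0 1)
      (f := fun _ (x : ℝ) => √(q.1 ^ 2 + q.2 ^ 2) * x) (fun _ => by fun_prop)
    simp only [ν, gauss_lin] at a1
    rw [← a2] at a1
    have a3 := congrArg (fun μ => μ T) a1
    rw [Measure.map_apply (by fun_prop) hT, Measure.map_apply (by fun_prop) hT] at a3
    refine Eq.trans a3 ?_
    rw [gm]
    congr 1
    ext w
    exact hhom _ hc w
  rw [lintegral_congr_ae e5]
  simp [ν]

lemma gm_coord_ne {m : ℕ} : gm (m+1) {w | w (Fin.last m) = 0} = 0 := by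
  have h := (measurePreserving_eval (fun _ : Fin (m+1) => gaussianReal 0 1) (Fin.last m)).measure_preimage
    (s := {0}) (by measurability)
  have : NullSingletonClass (gaussianReal 0 1) := nullSingletonClass_gaussianReal one_ne_zero
  rw [measure_singleton] at h
  exact h

lemma Dt_null {m : ℕ} : ((gm (m+2)).prod (gm (m+2))) {p | Dt p = 0} = 0 := by
  have := gauss_section (m := m) {w | w (Fin.last m) = 0}
    (measurableSet_eq_fun (by fun_prop) (by fun_prop)) (by
      intro c hc w; simp [hc.ne'])
  rw [gm_coord_ne] at this
  rw [← this]
  congr 1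
  ext p
  simp only [Set.mem_ofPred_eq, Dt]
  constructor <;> intro h <;> linarith

/-- The generic part of the event that the section meets the face. -/
def Sev (m : ℕ) : Set ((Fin (m+2) → ℝ) × (Fin (m+2) → ℝ)) :=
  {p | Dt p ≠ 0 ∧ ∀ i : Fin m,
    |p.1 i.castSucc.castSucc * (p.2 (Fin.last (m+1)) - p.2 (Fin.last m).castSucc) -
      p.2 i.castSucc.castSucc * (p.1 (Fin.last (m+1)) - p.1 (Fin.last m).castSucc)| ≤ |Dt p|}

def Tev (m : ℕ) : Set (Fin (m+1) → ℝ) :=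
  {w | w (Fin.last m) ≠ 0 ∧ ∀ i : Fin m, √2 * |w i.castSucc| ≤ |w (Fin.last m)|}

lemma measurable_Dt {m : ℕ} : Measurable (Dt (m := m)) := by
  unfold Dt; fun_prop

lemma Sev_meas (m : ℕ) : MeasurableSet (Sev m) := by
  have : MeasurableSet (⋂ i : Fin m, {p : (Fin (m+2) → ℝ) × (Fin (m+2) → ℝ) |
      |p.1 i.castSucc.castSucc * (p.2 (Fin.last (m+1)) - p.2 (Fin.last m).castSucc) -
      p.2 i.castSucc.castSucc * (p.1 (Fin.last (m+1)) - p.1 (Fin.last m).castSucc)| ≤ |Dt p|}) := by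
    refine MeasurableSet.iInter fun i => measurableSet_le ?_ ?_
    · exact Measurable.abs (by fun_prop)
    · exact measurable_Dt.abs
  convert (measurable_Dt (measurableSet_singleton 0).compl).inter this using 1
  ext p; simp [Sev]

lemma Tev_meas (m : ℕ) : MeasurableSet (Tev m) := by
  have : MeasurableSet (⋂ i : Fin m, {w : Fin (m+1) → ℝ | √2 * |w i.castSucc| ≤ |w (Fin.last m)|}) := by
    refine MeasurableSet.iInter fun i => measurableSet_le ?_ ?_
    · exact Measurable.const_mul (Measurable.abs (by fun_prop)) _
    · exact Measurable.abs (by fun_prop)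
  convert ((measurable_pi_apply (Fin.last m)) (measurableSet_singleton (0:ℝ)).compl).inter this using 1
  ext p; simp [Tev]

lemma Dt_lin {m : ℕ} (U V : Fin (m+2) → ℝ) (a b c d : ℝ) :
    Dt (a • U + b • V, c • U + d • V) = (a * d - b * c) * Dt (U, V) := by
  simp only [Dt, Pi.add_apply, Pi.smul_apply, smul_eq_mul]; ring

lemma Sev_inv {m : ℕ} (U V : Fin (m+2) → ℝ) (a b c d : ℝ) (h : a * d - b * c ≠ 0)
    (hS : (U, V) ∈ Sev m) : (a • U + b • V, c • U + d • V) ∈ Sev m := by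
  obtain ⟨h1, h2⟩ := hS
  refine ⟨?_, fun i => ?_⟩
  · rw [Dt_lin]; exact mul_ne_zero h h1
  · rw [Dt_lin, abs_mul]
    refine le_trans (le_of_eq ?_) (mul_le_mul_of_nonneg_left (h2 i) (abs_nonneg _))
    rw [← abs_mul]
    congr 1
    simp only [Pi.add_apply, Pi.smul_apply, smul_eq_mul]; ring

/-- The rotation by 45 degrees in the last two coordinates. -/
def rot (m : ℕ) : (Fin (m+2) → ℝ) →ₗ[ℝ] (Fin (m+2) → ℝ) where
  toFun x := Fin.snoc (α := fun _ => ℝ) (Fin.snoc (α := fun _ => ℝ) (fun i : Fin m => x i.castSucc.castSucc)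
    ((√2)⁻¹ * (x (Fin.last m).castSucc + x (Fin.last (m+1)))))
    ((√2)⁻¹ * (x (Fin.last (m+1)) - x (Fin.last m).castSucc))
  map_add' x y := by
    ext i
    refine Fin.lastCases ?_ (fun i => ?_) i
    · simp; ring
    · refine Fin.lastCases ?_ (fun i => ?_) i
      · simp; ring
      · simp
  map_smul' c x := by
    ext i
    refine Fin.lastCases ?_ (fun i => ?_) i
    · simp; ring
    · refine Fin.lastCases ?_ (fun i => ?_) i
      · simp; ring
      · simp

lemma rot_last {m : ℕ} (x : Fin (m+2) → ℝ) : rot m x (Fin.last (m+1)) =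
    (√2)⁻¹ * (x (Fin.last (m+1)) - x (Fin.last m).castSucc) := by simp [rot]
lemma rot_last' {m : ℕ} (x : Fin (m+2) → ℝ) : rot m x (Fin.last m).castSucc =
    (√2)⁻¹ * (x (Fin.last m).castSucc + x (Fin.last (m+1))) := by simp [rot]
lemma rot_cast {m : ℕ} (x : Fin (m+2) → ℝ) (i : Fin m) : rot m x i.castSucc.castSucc =
    x i.castSucc.castSucc := by simp [rot]

lemma inv_sq2 : (√2)⁻¹ * (√2)⁻¹ = (1/2 : ℝ) := by
  rw [← mul_inv, Real.mul_self_sqrt (by norm_num)]; norm_num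

lemma rot_mp (m : ℕ) : MeasurePreserving (rot m) (gm (m+2)) (gm (m+2)) := by
  apply gm_map_linear
  intro x
  rw [Fin.sum_univ_castSucc, Fin.sum_univ_castSucc, Fin.sum_univ_castSucc (n := m + 1), Fin.sum_univ_castSucc (n := m)]
  simp only [rot_last, rot_last', rot_cast]
  linear_combination 2 * (x (Fin.last m).castSucc ^ 2 + x (Fin.last (m+1)) ^ 2) * inv_sq2

lemma gauss_Sev (m : ℕ) : ((gm (m+2)).prod (gm (m+2))) (Sev m) = gm (m+1) (Tev m) := by
  have h1 := gauss_section (Tev m) (Tev_meas m) (by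
    intro c hc w
    simp only [Tev, Set.mem_ofPred_eq, Pi.smul_apply, smul_eq_mul, abs_mul, abs_of_pos hc]
    refine and_congr (by simp [hc.ne']) (forall_congr' fun i => ?_)
    rw [show √2 * (c * |w i.castSucc|) = c * (√2 * |w i.castSucc|) by ring]
    exact mul_le_mul_iff_right₀ hc)
  rw [← h1]
  have hp := (rot_mp m).prod (rot_mp m)
  set S1 := {p : (Fin (m+2) → ℝ) × (Fin (m+2) → ℝ) | (fun i : Fin (m+1) =>
      p.2 (Fin.last (m+1)) * p.1 i.castSucc - p.1 (Fin.last (m+1)) * p.2 i.castSucc) ∈ Tev m} with hS1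
  have hS1m : MeasurableSet S1 := by
    refine (measurable_pi_lambda _ fun i => ?_) (Tev_meas m)
    fun_prop
  rw [← hp.measure_preimage hS1m.nullMeasurableSet]
  congr 1
  ext ⟨U, V⟩
  have hD : rot m V (Fin.last (m+1)) * rot m U (Fin.last m).castSucc -
      rot m U (Fin.last (m+1)) * rot m V (Fin.last m).castSucc = Dt (U, V) := by
    simp only [rot_last, rot_last', Dt]
    linear_combination 2 * (U (Fin.last m).castSucc * V (Fin.last (m+1)) -
      V (Fin.last m).castSucc * U (Fin.last (m+1))) * inv_sq2
  simp only [Set.mem_preimage, Prod.map, S1, Tev, Sev, Set.mem_ofPred_eq, hD]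
  refine and_congr Iff.rfl (forall_congr' fun i => ?_)
  have h2 : √2 * |rot m V (Fin.last (m+1)) * rot m U i.castSucc.castSucc -
      rot m U (Fin.last (m+1)) * rot m V i.castSucc.castSucc| =
      |U i.castSucc.castSucc * (V (Fin.last (m+1)) - V (Fin.last m).castSucc) -
      V i.castSucc.castSucc * (U (Fin.last (m+1)) - U (Fin.last m).castSucc)| := by
    conv_lhs => rw [← abs_of_nonneg (Real.sqrt_nonneg 2), ← abs_mul]
    congr 1
    simp only [rot_last, rot_cast]
    have : √2 * (√2)⁻¹ = 1 := mul_inv_cancel₀ (by positivity)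
    linear_combination (U i.castSucc.castSucc * (V (Fin.last (m+1)) - V (Fin.last m).castSucc) -
      V i.castSucc.castSucc * (U (Fin.last (m+1)) - U (Fin.last m).castSucc)) * this
  rw [h2]

lemma act_E2 {m : ℕ} (g : OG (m+2)) (x : EuclideanSpace ℝ (Fin (m+2))) (hx : x ∈ Ek (m+2) 2)
    (i : Fin (m+2)) : act g x i = x 0 * col g 0 i + x 1 * col g 1 i := by
  simp only [act, Matrix.toLpLin_apply, Matrix.mulVec, dotProduct]
  rw [Fin.sum_univ_succ, Fin.sum_univ_succ, Finset.sum_eq_zero]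
  · simp [col]; ring
  · intro j _
    have := hx j.succ.succ (by simp)
    simp [this]

lemma event_subset {m : ℕ} (g : OG (m+2))
    (h : (act g '' Ek (m+2) 2 ∩ cubeFace (m+2) m).Nonempty) (hD : Dt (col g 0, col g 1) ≠ 0) :
    (col g 0, col g 1) ∈ Sev m := by
  obtain ⟨y, ⟨x, hx, rfl⟩, hy1, hy2⟩ := h
  have a1 := hy2 (Fin.last m).castSucc (by simp)
  have a2 := hy2 (Fin.last (m+1)) (by simp)
  rw [act_E2 g x hx] at a1 a2
  refine ⟨hD, fun i => ?_⟩
  have a3 := hy1 i.castSucc.castSucc (by simp)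
  rw [act_E2 g x hx] at a3
  simp only [Dt] at *
  set u := col g 0
  set v := col g 1
  have hx0 : x 0 * (u (Fin.last m).castSucc * v (Fin.last (m+1)) -
    v (Fin.last m).castSucc * u (Fin.last (m+1))) = v (Fin.last (m+1)) - v (Fin.last m).castSucc := by
    linear_combination v (Fin.last (m+1)) * a1 - v (Fin.last m).castSucc * a2
  have hx1 : x 1 * (u (Fin.last m).castSucc * v (Fin.last (m+1)) -
    v (Fin.last m).castSucc * u (Fin.last (m+1))) = -(u (Fin.last (m+1)) - u (Fin.last m).castSucc) := by
    linear_combination u (Fin.last m).castSucc * a2 - u (Fin.last (m+1)) * a1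
  have : u i.castSucc.castSucc * (v (Fin.last (m+1)) - v (Fin.last m).castSucc) -
      v i.castSucc.castSucc * (u (Fin.last (m+1)) - u (Fin.last m).castSucc) =
      (x 0 * u i.castSucc.castSucc + x 1 * v i.castSucc.castSucc) *
      (u (Fin.last m).castSucc * v (Fin.last (m+1)) -
    v (Fin.last m).castSucc * u (Fin.last (m+1))) := by
    linear_combination -u i.castSucc.castSucc * hx0 - v i.castSucc.castSucc * hx1
  rw [this, abs_mul]
  exact mul_le_of_le_one_left (abs_nonneg _) a3

lemma event_supset {m : ℕ} (g : OG (m+2)) (h : (col g 0, col g 1) ∈ Sev m) :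
    (act g '' Ek (m+2) 2 ∩ cubeFace (m+2) m).Nonempty := by
  obtain ⟨hD, h⟩ := h
  set u := col g 0 with hu
  set v := col g 1 with hv
  set D := Dt (u, v) with hDd
  let x : EuclideanSpace ℝ (Fin (m+2)) := WithLp.toLp 2 (fun i =>
    if i = 0 then (v (Fin.last (m+1)) - v (Fin.last m).castSucc) / D else
    if i = 1 then -(u (Fin.last (m+1)) - u (Fin.last m).castSucc) / D else 0)
  have hx : x ∈ Ek (m+2) 2 := by
    intro i hi
    have h0 : i ≠ 0 := by rintro rfl; simp at hi
    have h1 : i ≠ 1 := by rintro rfl; simp at hi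
    simp [x, h0, h1]
  have hx0 : x 0 = (v (Fin.last (m+1)) - v (Fin.last m).castSucc) / D := by simp [x]
  have hx1 : x 1 = -(u (Fin.last (m+1)) - u (Fin.last m).castSucc) / D := by simp [x]
  refine ⟨act g x, ⟨x, hx, rfl⟩, fun i hi => ?_, fun i hi => ?_⟩
  · rw [act_E2 g x hx, hx0, hx1]
    obtain ⟨j, rfl⟩ : ∃ j : Fin m, i = j.castSucc.castSucc := ⟨⟨i, hi⟩, rfl⟩
    have : (v (Fin.last (m+1)) - v (Fin.last m).castSucc) / D * u j.castSucc.castSucc +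
       -(u (Fin.last (m+1)) - u (Fin.last m).castSucc) / D * v j.castSucc.castSucc =
      (u j.castSucc.castSucc * (v (Fin.last (m+1)) - v (Fin.last m).castSucc) -
      v j.castSucc.castSucc * (u (Fin.last (m+1)) - u (Fin.last m).castSucc)) / D := by ring
    rw [← hu, ← hv, this, abs_div]
    exact div_le_one_of_le₀ (h j) (abs_nonneg _)
  · rw [act_E2 g x hx, hx0, hx1, ← hu, ← hv]
    have : i = (Fin.last m).castSucc ∨ i = Fin.last (m+1) := by
      have := i.2
      rcases (show (i:ℕ) = m ∨ (i:ℕ) = m + 1 by omega) with h | h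
      · left; ext; simpa using h
      · right; ext; simpa using h
    rcases this with rfl | rfl
    · field_simp
      rw [hDd]; simp only [Dt]; ring
    · field_simp
      rw [hDd]; simp only [Dt]; ring

lemma haar_event {m : ℕ} (H : Measure (OG (m+2))) [H.IsHaarMeasure] [IsProbabilityMeasure H] :
    H {g | (act g '' Ek (m+2) 2 ∩ cubeFace (m+2) m).Nonempty} = gm (m+1) (Tev m) := by
  rw [← gauss_Sev, ← haar_eq_gauss H Dt_null (Sev m) (Sev_meas m)
    (fun U V a b c d => Sev_inv U V a b c d)]
  have h0 := haar_eq_gauss H Dt_null {p | Dt p = 0} (measurable_Dt (measurableSet_singleton 0))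
    (by intro U V a b c d _ h
        have h' : Dt (U, V) = 0 := h
        show Dt _ = 0
        rw [Dt_lin, h', mul_zero])
  rw [Dt_null] at h0
  apply measure_congr
  have : ∀ᵐ g ∂H, Dt (col g 0, col g 1) ≠ 0 := by
    rw [ae_iff]; simpa using h0
  filter_upwards [this] with g hg
  exact propext ⟨fun h => event_subset g h hg, fun h => event_supset g h⟩

def Phi (t : ℝ) : ℝ := √(2 / π) * ∫ x in (0 : ℝ)..t, Real.exp (-x ^ 2 / 2)

lemma cont_e : Continuous fun x : ℝ => Real.exp (-x ^ 2 / 2) := by fun_prop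

lemma Phi_deriv (t : ℝ) : HasDerivAt Phi (√(2 / π) * Real.exp (-t ^ 2 / 2)) t :=
  (intervalIntegral.integral_hasDerivAt_right (cont_e.intervalIntegrable _ _)
    cont_e.stronglyMeasurable.stronglyMeasurableAtFilter cont_e.continuousAt).const_mul _

lemma Phi_cont : Continuous Phi :=
  continuous_iff_continuousAt.2 fun t => (Phi_deriv t).continuousAt

lemma Phi_nonneg {t : ℝ} (ht : 0 ≤ t) : 0 ≤ Phi t :=
  mul_nonneg (Real.sqrt_nonneg _) (intervalIntegral.integral_nonneg ht fun _ _ => (Real.exp_pos _).le)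

lemma int_e : Integrable fun x : ℝ => Real.exp (-x ^ 2 / 2) := by
  have := integrable_exp_neg_mul_sq (b := 1/2) (by norm_num)
  convert this using 2
  ring_nf

lemma Phi_total : √(2 / π) * ∫ x in Set.Ioi (0:ℝ), Real.exp (-x ^ 2 / 2) = 1 := by
  have := integral_gaussian_Ioi (1/2)
  have h2 : ∫ x in Set.Ioi (0:ℝ), Real.exp (-x ^ 2 / 2) = √(π / (1/2)) / 2 := by
    rw [← this]
    congr 1
    ext x; ring_nf
  rw [h2, ← mul_div_assoc, ← Real.sqrt_mul (by positivity)]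
  rw [show 2 / π * (π / (1/2)) = (2:ℝ)^2 by field_simp, Real.sqrt_sq (by norm_num)]
  norm_num

lemma one_sub_Phi (t : ℝ) : 1 - Phi t = √(2 / π) * ∫ x in Set.Ioi t, Real.exp (-x ^ 2 / 2) := by
  rw [← Phi_total, Phi, ← mul_sub]
  congr 1
  have := intervalIntegral.integral_interval_add_Ioi (a := 0) (b := t) int_e.integrableOn int_e.integrableOn
  linarith

lemma Phi_le_one (t : ℝ) : Phi t ≤ 1 := by
  have := one_sub_Phi t
  have h : 0 ≤ √(2 / π) * ∫ x in Set.Ioi t, Real.exp (-x ^ 2 / 2) :=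
    mul_nonneg (Real.sqrt_nonneg _) (integral_nonneg fun _ => (Real.exp_pos _).le)
  linarith

lemma Phi_tail (t : ℝ) : 1 - Phi t ≤ √(2 / π) * (Real.exp (1/2) * Real.exp (-t)) := by
  rw [one_sub_Phi]
  refine mul_le_mul_of_nonneg_left ?_ (Real.sqrt_nonneg _)
  rw [← integral_exp_neg_Ioi t, ← integral_const_mul]
  refine setIntegral_mono int_e.integrableOn ((integrableOn_exp_neg_Ioi t).const_mul _) fun x => ?_
  simp only
  rw [← Real.exp_add]
  apply Real.exp_le_exp.2
  nlinarith [sq_nonneg (x - 1)]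

lemma tail_bound (n : ℕ) {t : ℝ} (ht : 0 ≤ t) :
    1 - Phi t ^ n ≤ (n * √(2 / π) * Real.exp (1/2)) * Real.exp (-t) := by
  have h1 := one_add_mul_le_pow (a := Phi t - 1) (by linarith [Phi_nonneg ht]) n
  have h2 := mul_le_mul_of_nonneg_left (Phi_tail t) (Nat.cast_nonneg (α := ℝ) n)
  have h3 : 1 + (Phi t - 1) = Phi t := by ring
  rw [h3] at h1
  nlinarith

lemma int_tail (n : ℕ) : IntegrableOn (fun t => 1 - Phi t ^ n) (Set.Ioi 0) := by
  refine Integrable.mono' ((integrableOn_exp_neg_Ioi 0).const_mul (n * √(2 / π) * Real.exp (1/2)))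
    (by have := Phi_cont; fun_prop) ?_
  refine (ae_restrict_iff' measurableSet_Ioi).2 (ae_of_all _ fun t ht => ?_)
  rw [Real.norm_of_nonneg]
  · exact tail_bound n (le_of_lt ht)
  · linarith [pow_le_one₀ (n := n) (Phi_nonneg (le_of_lt ht)) (Phi_le_one t)]

lemma int_sq (m : ℕ) : IntegrableOn (fun t => Real.exp (-t ^ 2) * Phi t ^ m) (Set.Ioi 0) := by
  have h : Integrable fun x : ℝ => Real.exp (-x ^ 2) := by
    simpa using integrable_exp_neg_mul_sq (b := 1) (by norm_num)
  refine Integrable.mono' h.integrableOn (by have := Phi_cont; fun_prop) ?_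
  refine (ae_restrict_iff' measurableSet_Ioi).2 (ae_of_all _ fun t ht => ?_)
  have h0 := pow_nonneg (Phi_nonneg (le_of_lt ht)) m
  have h1 := pow_le_one₀ (n := m) (Phi_nonneg (le_of_lt ht)) (Phi_le_one t)
  rw [Real.norm_of_nonneg (by positivity)]
  exact mul_le_of_le_one_right (Real.exp_pos _).le h1

lemma parts (m : ℕ) : ∫ t in Set.Ioi (0:ℝ), (1 - Phi t ^ (m+2)) =
    (m+2) * (m+1) * (2 / π) * ∫ t in Set.Ioi (0:ℝ), Real.exp (-t ^ 2) * Phi t ^ m := by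
  have hs : √(2 / π) * √(2 / π) = 2 / π := Real.mul_self_sqrt (by positivity)
  let F : ℝ → ℝ := fun t => t * (1 - Phi t ^ (m+2)) -
    (m+2) * ((√(2 / π) * Real.exp (-t ^ 2 / 2)) * Phi t ^ (m+1))
  have hF : ∀ t, HasDerivAt F ((1 - Phi t ^ (m+2)) -
      (m+2) * (m+1) * (2 / π) * (Real.exp (-t ^ 2) * Phi t ^ m)) t := by
    intro t
    have hP := Phi_deriv t
    have he : HasDerivAt (fun t : ℝ => Real.exp (-t ^ 2 / 2)) (-t * Real.exp (-t ^ 2 / 2)) t := by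
      have : HasDerivAt (fun t : ℝ => -t ^ 2 / 2) (-t) t := by
        have := ((hasDerivAt_pow 2 t).fun_neg).div_const 2
        refine this.congr_deriv ?_
        simp only [Nat.cast_ofNat, Nat.add_one_sub_one, pow_one]
        ring
      convert this.exp using 1; ring
    have h1 := (hasDerivAt_id t).mul ((hP.pow (m+2)).const_sub 1)
    have h2 := ((he.const_mul (√(2 / π))).mul (hP.pow (m+1))).const_mul ((m:ℝ)+2)
    have hE : Real.exp (-t ^ 2) = Real.exp (-t ^ 2 / 2) * Real.exp (-t ^ 2 / 2) := by
      rw [← Real.exp_add]; ring_nf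
    have h3 := h1.sub h2
    have hFF : (id * fun t => 1 - (Phi ^ (m+2)) t) - (fun y => ((m:ℝ)+2) *
      (((fun y => √(2 / π) * Real.exp (-y ^ 2 / 2)) * Phi ^ (m+1)) y)) = F := by
      ext t; simp [F]
    refine HasDerivAt.congr_deriv (f := F) (hFF ▸ h3) ?_
    simp only [id, Pi.pow_apply, Nat.add_sub_cancel, show m + 2 - 1 = m + 1 from rfl]
    push_cast
    rw [hE]
    linear_combination (m+2) * (m+1) * Real.exp (-t ^ 2 / 2) * Real.exp (-t ^ 2 / 2) * Phi t ^ m * (-hs)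
  have hlim : Tendsto F atTop (nhds 0) := by
    have t1 : Tendsto (fun t => t * (1 - Phi t ^ (m+2))) atTop (nhds 0) := by
      have : Tendsto (fun t : ℝ => (((m+2:ℕ):ℝ) * √(2 / π) * Real.exp (1/2)) * (t * Real.exp (-t))) atTop (nhds 0) := by
        have := (Real.tendsto_pow_mul_exp_neg_atTop_nhds_zero 1).const_mul (((m+2:ℕ):ℝ) * √(2 / π) * Real.exp (1/2))
        simpa using this
      refine squeeze_zero' ?_ ?_ this
      · filter_upwards [eventually_ge_atTop 0] with t ht
        have := pow_le_one₀ (n := m+2) (Phi_nonneg ht) (Phi_le_one t)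
        exact mul_nonneg ht (by linarith)
      · filter_upwards [eventually_ge_atTop 0] with t ht
        have := mul_le_mul_of_nonneg_left (tail_bound (m+2) ht) ht
        linarith
    have t2 : Tendsto (fun t => ((m:ℝ)+2) * ((√(2 / π) * Real.exp (-t ^ 2 / 2)) * Phi t ^ (m+1))) atTop (nhds 0) := by
      have : Tendsto (fun t : ℝ => ((m:ℝ)+2) * (√(2 / π) * Real.exp (1/2) * Real.exp (-t))) atTop (nhds 0) := by
        have := (Real.tendsto_exp_neg_atTop_nhds_zero.const_mul (√(2 / π) * Real.exp (1/2))).const_mul ((m:ℝ)+2)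
        simpa using this
      refine squeeze_zero' ?_ ?_ this
      · filter_upwards [eventually_ge_atTop 0] with t ht
        have := Phi_nonneg ht
        positivity
      · filter_upwards [eventually_ge_atTop 0] with t ht
        refine mul_le_mul_of_nonneg_left ?_ (by positivity)
        refine (mul_le_of_le_one_right (by positivity)
          (pow_le_one₀ (Phi_nonneg ht) (Phi_le_one t))).trans ?_
        rw [mul_assoc, ← Real.exp_add]
        refine mul_le_mul_of_nonneg_left (Real.exp_le_exp.2 ?_) (Real.sqrt_nonneg _)
        nlinarith [sq_nonneg (t - 1)]
    have t3 := t1.sub t2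
    rw [sub_zero] at t3
    exact t3
  have hi1 := int_tail (m+2)
  have hi2 := (int_sq m).const_mul (((m:ℝ)+2) * (m+1) * (2 / π))
  have h := integral_Ioi_of_hasDerivAt_of_tendsto (hF 0).continuousAt.continuousWithinAt
    (fun t _ => hF t) (hi1.sub hi2) hlim
  have hF0 : F 0 = 0 := by simp [F, Phi]
  rw [integral_sub hi1 hi2, integral_const_mul, hF0] at h
  linarith

lemma gauss_abs {t : ℝ} (ht : 0 ≤ t) : gaussianReal 0 1 {z | |z| ≤ t} = ENNReal.ofReal (Phi t) := by
  rw [gaussianReal_apply_eq_integral 0 one_ne_zero]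
  congr 1
  have hset : {z : ℝ | |z| ≤ t} = Set.Icc (-t) t := by ext z; simp [abs_le]
  rw [hset, integral_Icc_eq_integral_Ioc, ← intervalIntegral.integral_of_le (by linarith)]
  have hpdf : gaussianPDFReal 0 1 = fun x => (√(2 * π))⁻¹ * Real.exp (-x ^ 2 / 2) := by
    ext x; simp [gaussianPDFReal]
  rw [hpdf, intervalIntegral.integral_const_mul,
    ← intervalIntegral.integral_add_adjacent_intervals (b := 0)
      (cont_e.intervalIntegrable _ _) (cont_e.intervalIntegrable _ _)]
  have h1 : ∫ x in (-t)..0, Real.exp (-x ^ 2 / 2) = ∫ x in (0:ℝ)..t, Real.exp (-x ^ 2 / 2) := by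
    have := intervalIntegral.integral_comp_neg (a := 0) (b := t) (fun x => Real.exp (-x ^ 2 / 2))
    simp only [neg_sq, neg_zero] at this
    exact this.symm
  have h2 : √(2 / π) = 2 * (√(2 * π))⁻¹ := by
    rw [← Real.sqrt_inv, show (2 / π : ℝ) = 2 ^ 2 * (2 * π)⁻¹ by field_simp,
      Real.sqrt_mul (by positivity), Real.sqrt_sq (by norm_num)]
  rw [h1, Phi, h2]; ring

lemma gm_Tev (m : ℕ) : gm (m+1) (Tev m) =
    ∫⁻ y, ENNReal.ofReal (Phi (|y| / √2) ^ m) ∂(gaussianReal 0 1) := by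
  have P2 := measurePreserving_piFinSuccAbove (fun _ : Fin (m+1) => gaussianReal 0 1) (Fin.last m)
  let S2 : Set (ℝ × (Fin m → ℝ)) := {z | z.1 ≠ 0 ∧ ∀ i, √2 * |z.2 i| ≤ |z.1|}
  have hS2 : MeasurableSet S2 := by
    have : MeasurableSet (⋂ i : Fin m, {z : ℝ × (Fin m → ℝ) | √2 * |z.2 i| ≤ |z.1|}) := by
      refine MeasurableSet.iInter fun i => measurableSet_le ?_ ?_
      · exact Measurable.const_mul (Measurable.abs (by fun_prop)) _
      · exact Measurable.abs (by fun_prop)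
    convert ((measurable_fst) (measurableSet_singleton (0:ℝ)).compl).inter this using 1
    ext p; simp [S2]
  have e2 := P2.measure_preimage hS2.nullMeasurableSet
  have e3 : (MeasurableEquiv.piFinSuccAbove (fun _ : Fin (m+1) => ℝ) (Fin.last m)) ⁻¹' S2 = Tev m := by
    ext z
    simp [S2, Tev, MeasurableEquiv.piFinSuccAbove, Fin.init]
  rw [e3] at e2
  refine Eq.trans e2 ?_
  rw [Measure.prod_apply hS2]
  have : NullSingletonClass (gaussianReal 0 1) := nullSingletonClass_gaussianReal one_ne_zero
  have h0 : ∀ᵐ x ∂(gaussianReal 0 1), x ≠ 0 := by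
    rw [ae_iff]; simp
  refine lintegral_congr_ae ?_
  filter_upwards [h0] with y hy
  have hset : Prod.mk y ⁻¹' S2 = Set.univ.pi (fun _ : Fin m => {z : ℝ | |z| ≤ |y| / √2}) := by
    ext z
    simp only [S2, Set.mem_preimage, Set.mem_ofPred_eq, Set.mem_pi, Set.mem_univ, true_implies]
    rw [and_iff_right hy]
    refine forall_congr' fun i => ?_
    rw [le_div_iff₀ (by positivity), mul_comm]
  rw [hset, Measure.pi_pi, gauss_abs (by positivity), Finset.prod_const, Finset.card_univ,
    Fintype.card_fin, ENNReal.ofReal_pow (Phi_nonneg (by positivity))]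

lemma gm_Tev_real (m : ℕ) : (gm (m+1) (Tev m)).toReal =
    2 / √π * ∫ t in Set.Ioi (0:ℝ), Real.exp (-t ^ 2) * Phi t ^ m := by
  have hPc := Phi_cont
  rw [gm_Tev, ← integral_eq_lintegral_of_nonneg_ae
    (ae_of_all _ fun y => pow_nonneg (Phi_nonneg (by positivity)) m)
    (Continuous.aestronglyMeasurable (by fun_prop)),
    integral_gaussianReal_eq_integral_smul one_ne_zero]
  let h : ℝ → ℝ := fun y => (√(2 * π))⁻¹ * Real.exp (-y ^ 2 / 2) * Phi (y / √2) ^ m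
  have e1 : ∫ x, gaussianPDFReal 0 1 x • Phi (|x| / √2) ^ m = ∫ x, h |x| := by
    congr 1; ext x
    simp [h, gaussianPDFReal]
  rw [e1, integral_comp_abs (f := h)]
  have e2 := integral_comp_mul_left_Ioi h 0 (b := √2) (by positivity)
  rw [mul_zero, smul_eq_mul] at e2
  have h2 : √2 ≠ 0 := by positivity
  have e3 : ∫ x in Set.Ioi (0:ℝ), h x = √2 * ∫ x in Set.Ioi (0:ℝ), h (√2 * x) := by
    rw [e2, ← mul_assoc, mul_inv_cancel₀ h2, one_mul]
  have e4 : (fun x => h (√2 * x)) = fun x => (√(2 * π))⁻¹ * (Real.exp (-x ^ 2) * Phi x ^ m) := by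
    ext x
    simp only [h]
    rw [mul_div_cancel_left₀ _ h2, mul_pow, Real.sq_sqrt (by norm_num), mul_assoc]
    congr 3
    ring
  rw [e3, e4, integral_const_mul, Real.sqrt_mul (by norm_num)]
  field_simp

/-- `f(0,2,n) = 2√π · E(max |gᵢ|) = 2√π ∫₀^∞ (1 - (√(2/π) ∫₀^t e^{-x²/2} dx)ⁿ) dt`. -/
theorem expected_vertices_two_dim_section (n : ℕ) (hn : 3 ≤ n)
    (H : Measure (OG n)) [H.IsHaarMeasure] [IsProbabilityMeasure H] :
    expFaces n H 0 2 =
      2 * Real.sqrt π *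
        ∫ t in Set.Ioi (0 : ℝ),
          (1 - (Real.sqrt (2 / π) * ∫ x in (0 : ℝ)..t, Real.exp (-x ^ 2 / 2)) ^ n) := by
  obtain ⟨m, rfl⟩ : ∃ m, n = m + 2 := ⟨n - 2, by omega⟩
  have hp := parts m
  simp only [Phi] at hp
  have h1 := haar_event H
  have h2 := gm_Tev_real m
  simp only [Phi] at h2
  rw [hp, expFaces]
  simp only [show m + 2 - 2 + 0 = m from rfl, show 2 - 0 = 2 from rfl]
  rw [h1, h2, Nat.cast_choose_two]
  have hs : √π * √π = π := Real.mul_self_sqrt Real.pi_pos.le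
  have hs0 : √π ≠ 0 := by positivity
  push_cast
  generalize (∫ t in Set.Ioi (0 : ℝ), Real.exp (-t ^ 2) *
    (√(2 / π) * ∫ x in (0 : ℝ)..t, Real.exp (-x ^ 2 / 2)) ^ m) = I
  have hq : 2 / √π = √π * (2 / π) := by
    rw [div_eq_iff hs0, show √π * (2 / π) * √π = (√π * √π) * (2 / π) by ring, hs]
    field_simp
  rw [hq]
  ring
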